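/- Even-order lemma for K (Lemma 1): the function G(Δr) := K(Δr)/Δr, where K(Δr) is defined by the same finite-sum formula for every real Δr with |v·Δr/D| < 2 (positive or negative), is an even function of Δr: G(−Δr) = G(Δr) for all sufficiently small |Δr|. Consequently G is smooth at Δr = 0 and all its odd-order Taylor coefficients at Δr = 0 vanish, so the order exponent of K/(β·Δr) (for m ≠ 0) or of K/Δr (for m = 0) with respect to Δr is an even number; this parity is produced by the summations over the two trits ω and u₀ alone. -/

import Mathlib

open Filter Finset

noncomputable section

/-- Transition probability η on trits: η(0) = (β/2)(1 − Pe/2), η(1) = 1 − β,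
η(2) = (β/2)(1 + Pe/2). -/
def eta (β Pe : ℝ) (ω : Fin 3) : ℝ :=
  if (ω : ℕ) = 0 then β / 2 * (1 - Pe / 2)
  else if (ω : ℕ) = 1 then 1 - β
  else β / 2 * (1 + Pe / 2)

/-- ν(ω) = η(2 − ω). -/
def nu (β Pe : ℝ) (ω : Fin 3) : ℝ :=
  if (ω : ℕ) = 0 then β / 2 * (1 + Pe / 2)
  else if (ω : ℕ) = 1 then 1 - β
  else β / 2 * (1 - Pe / 2)

/-- Bulk local density ρ̂ⱼ(u′) = (∏ η(u_d)/ν(u_d)) · ρ₀(r + (j + Σ (1 − u_d))·Δr). -/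
def rhoHat (β Pe r Δr : ℝ) (ρ₀ : ℝ → ℝ) {K : ℕ} (j : ℤ) (u : Fin K → Fin 3) : ℝ :=
  (∏ d, eta β Pe (u d) / nu β Pe (u d)) *
    ρ₀ (r + ((j : ℝ) + ∑ d, (1 - ((u d : ℕ) : ℝ))) * Δr)

/-- F_j(ω, u) with u = u₀u′ :
F_j(ω,u) = f((η(ω)/ν(ω))·ρ̂_j(u′), (η(u₀)/ν(u₀))·ρ̂_{j+1−u₀}(u′)). -/
def Floc (β Pe r Δr : ℝ) (ρ₀ : ℝ → ℝ) (f : ℝ → ℝ → ℝ) {K : ℕ}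
    (j : ℤ) (ω u₀ : Fin 3) (u' : Fin K → Fin 3) : ℝ :=
  f (eta β Pe ω / nu β Pe ω * rhoHat β Pe r Δr ρ₀ j u')
    (eta β Pe u₀ / nu β Pe u₀ * rhoHat β Pe r Δr ρ₀ (j + 1 - ((u₀ : ℕ) : ℤ)) u')

/-- K(Δr): the sum over the trit ω and the k-digit trit string u = u₀u′. -/
def Ksum (D v β r : ℝ) (k : ℕ) (ρ₀ : ℝ → ℝ) (f : ℝ → ℝ → ℝ)
    (ε δ : ℝ) (m : ℕ) (Δr : ℝ) : ℝ :=
  Δr * ∑ ω : Fin 3, ∑ u₀ : Fin 3, ∑ u' : Fin (k - 1) → Fin 3,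
    (eta β (v * Δr / D) ω + δ * nu β (v * Δr / D) ω) *
      (nu β (v * Δr / D) u₀ * ∏ d, nu β (v * Δr / D) (u' d)) *
      (Floc β (v * Δr / D) r Δr ρ₀ f 0 ω u₀ u' +
        ε * (-1 : ℝ) ^ m * Floc β (v * Δr / D) r Δr ρ₀ f (1 - ((ω : ℕ) : ℤ)) ω u₀ u')

/-- The spatio-temporally averaged T¹-type quantity ⟨A⟩(Δr) = K/(τ·Δr),
with τ = β·Δr²/(2D). -/
def avgA (D v β r : ℝ) (k : ℕ) (ρ₀ : ℝ → ℝ) (f : ℝ → ℝ → ℝ)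
    (ε δ : ℝ) (m : ℕ) (Δr : ℝ) : ℝ :=
  Ksum D v β r k ρ₀ f ε δ m Δr / (β * Δr ^ 2 / (2 * D) * Δr)

/-- f̃(X,Y) = f(Y + X, Y − X). -/
def ftilde (f : ℝ → ℝ → ℝ) (X Y : ℝ) : ℝ := f (Y + X) (Y - X)

/-- G(Δr) = K(Δr)/Δr : the sum defining K without its Δr prefactor, defined for
every real Δr (positive or negative). -/
def Ssum (D v β r : ℝ) (k : ℕ) (ρ₀ : ℝ → ℝ) (f : ℝ → ℝ → ℝ)
    (ε δ : ℝ) (m : ℕ) (Δr : ℝ) : ℝ :=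
  ∑ ω : Fin 3, ∑ u₀ : Fin 3, ∑ u' : Fin (k - 1) → Fin 3,
    (eta β (v * Δr / D) ω + δ * nu β (v * Δr / D) ω) *
      (nu β (v * Δr / D) u₀ * ∏ d, nu β (v * Δr / D) (u' d)) *
      (Floc β (v * Δr / D) r Δr ρ₀ f 0 ω u₀ u' +
        ε * (-1 : ℝ) ^ m * Floc β (v * Δr / D) r Δr ρ₀ f (1 - ((ω : ℕ) : ℤ)) ω u₀ u')

theorem eta_neg_rev (β Pe : ℝ) (ω : Fin 3) : eta β (-Pe) ω.rev = eta β Pe ω := by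
  fin_cases ω <;> simp [eta, Fin.rev, neg_div, sub_eq_add_neg]

theorem nu_neg_rev (β Pe : ℝ) (ω : Fin 3) : nu β (-Pe) ω.rev = nu β Pe ω := by
  fin_cases ω <;> simp [nu, Fin.rev, neg_div, sub_eq_add_neg]

theorem cast_val_rev_fin_three (ω : Fin 3) : ((ω.rev : ℕ) : ℤ) = 2 - ((ω : ℕ) : ℤ) := by
  rw [Fin.val_rev]
  omega

theorem rhoHat_neg_rev (β Pe r Δr : ℝ) (ρ₀ : ℝ → ℝ) {K : ℕ} (j : ℤ) (u : Fin K → Fin 3) :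
    rhoHat β (-Pe) r (-Δr) ρ₀ j (fun d => (u d).rev) = rhoHat β Pe r Δr ρ₀ (-j) u := by
  have hcast : ∀ ω : Fin 3, ((ω.rev : ℕ) : ℝ) = 2 - ((ω : ℕ) : ℝ) := fun ω => by
    exact_mod_cast congrArg (Int.cast : ℤ → ℝ) (cast_val_rev_fin_three ω)
  have hsum : ∑ d, (1 - (((u d).rev : ℕ) : ℝ)) = -∑ d, (1 - ((u d : ℕ) : ℝ)) := by
    rw [← Finset.sum_neg_distrib]
    refine Finset.sum_congr rfl fun d _ => ?_
    rw [hcast]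
    ring
  simp only [rhoHat, eta_neg_rev, nu_neg_rev, hsum]
  congr 2
  push_cast
  ring

theorem Floc_neg_rev (β Pe r Δr : ℝ) (ρ₀ : ℝ → ℝ) (f : ℝ → ℝ → ℝ) {K : ℕ}
    (j : ℤ) (ω u₀ : Fin 3) (u' : Fin K → Fin 3) :
    Floc β (-Pe) r (-Δr) ρ₀ f j ω.rev u₀.rev (fun d => (u' d).rev) =
      Floc β Pe r Δr ρ₀ f (-j) ω u₀ u' := by
  have hj : -(j + 1 - ((u₀.rev : ℕ) : ℤ)) = -j + 1 - ((u₀ : ℕ) : ℤ) := by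
    rw [cast_val_rev_fin_three]
    ring
  simp only [Floc, eta_neg_rev, nu_neg_rev, rhoHat_neg_rev, hj]

/-- Reversing every trit `ω ↦ 2 - ω` in the sum undoes the sign change of `Δr`. -/
theorem Ssum_neg (D v β r : ℝ) (k : ℕ) (ρ₀ : ℝ → ℝ) (f : ℝ → ℝ → ℝ)
    (ε δ : ℝ) (m : ℕ) (Δr : ℝ) :
    Ssum D v β r k ρ₀ f ε δ m (-Δr) = Ssum D v β r k ρ₀ f ε δ m Δr := by
  have hPe : v * -Δr / D = -(v * Δr / D) := by ring
  unfold Ssum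
  rw [hPe, ← Equiv.sum_comp Fin.revPerm]
  refine Finset.sum_congr rfl fun ω _ => ?_
  rw [← Equiv.sum_comp Fin.revPerm]
  refine Finset.sum_congr rfl fun u₀ _ => ?_
  rw [← Equiv.sum_comp (Equiv.arrowCongr (Equiv.refl (Fin (k - 1))) (Fin.revPerm (n := 3)))]
  refine Finset.sum_congr rfl fun u' _ => ?_
  have hu : Equiv.arrowCongr (Equiv.refl (Fin (k - 1))) (Fin.revPerm (n := 3)) u' =
      fun d => (u' d).rev := rfl
  have hj : -(1 - ((ω.rev : ℕ) : ℤ)) = 1 - ((ω : ℕ) : ℤ) := by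
    rw [cast_val_rev_fin_three]
    ring
  simp only [hu, Fin.revPerm_apply, eta_neg_rev, nu_neg_rev, Floc_neg_rev, hj, neg_zero]

theorem contDiff_eta (β c D : ℝ) (n : WithTop ℕ∞) (ω : Fin 3) :
    ContDiff ℝ n fun x : ℝ => eta β (c * x / D) ω := by
  unfold eta
  split_ifs <;> fun_prop

theorem contDiff_nu (β c D : ℝ) (n : WithTop ℕ∞) (ω : Fin 3) :
    ContDiff ℝ n fun x : ℝ => nu β (c * x / D) ω := by
  unfold nu
  split_ifs <;> fun_prop

theorem nu_zero_ne_zero {β : ℝ} (hβ0 : 0 < β) (hβ1 : β < 1) (ω : Fin 3) : nu β 0 ω ≠ 0 := by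
  unfold nu
  split_ifs
  · simpa using hβ0.ne'
  · exact (sub_pos.2 hβ1).ne'
  · simpa using hβ0.ne'

theorem contDiffAt_eta_div_nu {β : ℝ} (hβ0 : 0 < β) (hβ1 : β < 1) (c D : ℝ) (n : WithTop ℕ∞)
    (ω : Fin 3) :
    ContDiffAt ℝ n (fun x : ℝ => eta β (c * x / D) ω / nu β (c * x / D) ω) 0 :=
  (contDiff_eta β c D n ω).contDiffAt.div (contDiff_nu β c D n ω).contDiffAt
    (by simpa using nu_zero_ne_zero hβ0 hβ1 ω)

theorem contDiffAt_rhoHat {β : ℝ} (hβ0 : 0 < β) (hβ1 : β < 1) (c D r : ℝ) {n : WithTop ℕ∞}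
    {ρ₀ : ℝ → ℝ} (hρ : ContDiff ℝ n ρ₀) {K : ℕ} (j : ℤ) (u : Fin K → Fin 3) :
    ContDiffAt ℝ n (fun x : ℝ => rhoHat β (c * x / D) r x ρ₀ j u) 0 := by
  unfold rhoHat
  refine ContDiffAt.mul (contDiffAt_prod fun d _ => contDiffAt_eta_div_nu hβ0 hβ1 c D n (u d)) ?_
  exact (hρ.comp (by fun_prop)).contDiffAt

theorem contDiffAt_Floc {β : ℝ} (hβ0 : 0 < β) (hβ1 : β < 1) (c D r : ℝ) {n : WithTop ℕ∞}
    {ρ₀ : ℝ → ℝ} (hρ : ContDiff ℝ n ρ₀) {f : ℝ → ℝ → ℝ} (hf : ContDiff ℝ n (Function.uncurry f))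
    {K : ℕ} (j : ℤ) (ω u₀ : Fin 3) (u' : Fin K → Fin 3) :
    ContDiffAt ℝ n (fun x : ℝ => Floc β (c * x / D) r x ρ₀ f j ω u₀ u') 0 :=
  hf.contDiffAt.comp (0 : ℝ)
    (((contDiffAt_eta_div_nu hβ0 hβ1 c D n ω).mul (contDiffAt_rhoHat hβ0 hβ1 c D r hρ j u')).prodMk
      ((contDiffAt_eta_div_nu hβ0 hβ1 c D n u₀).mul (contDiffAt_rhoHat hβ0 hβ1 c D r hρ _ u')))

theorem contDiffAt_Ssum {β : ℝ} (hβ0 : 0 < β) (hβ1 : β < 1) (D v r : ℝ) (k : ℕ)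
    {n : WithTop ℕ∞} {ρ₀ : ℝ → ℝ} (hρ : ContDiff ℝ n ρ₀)
    {f : ℝ → ℝ → ℝ} (hf : ContDiff ℝ n (Function.uncurry f)) (ε δ : ℝ) (m : ℕ) :
    ContDiffAt ℝ n (Ssum D v β r k ρ₀ f ε δ m) 0 := by
  unfold Ssum
  refine ContDiffAt.sum fun ω _ => ContDiffAt.sum fun u₀ _ => ContDiffAt.sum fun u' _ => ?_
  have hη := (contDiff_eta β v D n ω).contDiffAt (x := 0)
  have hν := fun ω => (contDiff_nu β v D n ω).contDiffAt (x := 0)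
  have hF := fun j => contDiffAt_Floc hβ0 hβ1 v D r hρ hf j ω u₀ u'
  exact ((hη.add (contDiffAt_const.mul (hν ω))).mul
    ((hν u₀).mul (contDiffAt_prod fun d _ => hν (u' d)))).mul
      ((hF 0).add (contDiffAt_const.mul (hF _)))

theorem iteratedDeriv_zero_of_even_of_odd {g : ℝ → ℝ} (hg : ∀ x, g (-x) = g x) {j : ℕ}
    (hj : Odd j) : iteratedDeriv j g 0 = 0 := by
  have h := iteratedDeriv_comp_neg j g 0
  simp only [hg, neg_zero, hj.neg_one_pow, neg_smul, one_smul] at h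
  linarith

/-- Even-order lemma for K (Lemma 1): G(Δr) := K(Δr)/Δr is an even function of Δr
near 0; consequently it is smooth at Δr = 0 and all its odd-order Taylor
coefficients there vanish (so the order exponent of K/(βΔr) resp. K/Δr is even,
a parity produced by the summations over the two trits ω and u₀ alone). -/
theorem even_order_lemma_for_K
    (D v β r : ℝ) (k : ℕ) (ρ₀ : ℝ → ℝ) (f : ℝ → ℝ → ℝ)
    (ε δ : ℝ) (m : ℕ) (Chat : ℝ → ℝ)
    (hD : 0 < D) (hβ0 : 0 < β) (hβ1 : β < 1) (hk : 1 ≤ k)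
    (hρ : ContDiff ℝ (⊤ : ℕ∞) ρ₀) (hρpos : ∀ x, 0 < ρ₀ x)
    (hf : ContDiff ℝ (⊤ : ℕ∞) (Function.uncurry f))
    (hε : ε = 1 ∨ ε = -1) (hδ : δ = 1 ∨ δ = -1)
    (hsym : ∀ x y, f y x = (-1 : ℝ) ^ m * f x y)
    (hlow : ∀ Y : ℝ, ∀ j < m, iteratedDeriv j (fun X => ftilde f X Y) 0 = 0)
    (hchar : ∀ Y : ℝ, iteratedDeriv m (fun X => ftilde f X Y) 0 = (m.factorial : ℝ) * Chat Y)
    (hCbdd : ∃ M : ℝ, ∀ y, |Chat y| ≤ M) (hCne : ∀ y, Chat y ≠ 0)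
    :
    (∀ Δr : ℝ, Δr ≠ 0 →
        Ssum D v β r k ρ₀ f ε δ m Δr = Ksum D v β r k ρ₀ f ε δ m Δr / Δr) ∧
    (∃ Δ₀ > 0, ∀ Δr : ℝ, |Δr| < Δ₀ →
        Ssum D v β r k ρ₀ f ε δ m (-Δr) = Ssum D v β r k ρ₀ f ε δ m Δr) ∧
    ContDiffAt ℝ (⊤ : ℕ∞) (Ssum D v β r k ρ₀ f ε δ m) 0 ∧
    (∀ j : ℕ, Odd j → iteratedDeriv j (Ssum D v β r k ρ₀ f ε δ m) 0 = 0) := by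
  refine ⟨fun Δr hΔr => (mul_div_cancel_left₀ _ hΔr).symm,
    ⟨1, one_pos, fun Δr _ => Ssum_neg D v β r k ρ₀ f ε δ m Δr⟩,
    contDiffAt_Ssum hβ0 hβ1 D v r k hρ hf ε δ m,
    fun j hj => iteratedDeriv_zero_of_even_of_odd (Ssum_neg D v β r k ρ₀ f ε δ m) hj⟩
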